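/- Let Σ be a complete connected translating graph in a direction v_θ = sin θ·e₃ + cos θ·e₂ (θ ∈ [0,π)), with Gauss map N : Σ → S², and let 𝓗 = {p ∈ Σ : ⟨N(p), e₃⟩ = 0} be the zero set of the mean curvature of Σ. Then no nonempty connected component of 𝓗 is compact. -/

import Mathlib

open MeasureTheory Metric Real EuclideanSpace
open scoped RealInnerProductSpace ENNReal NNReal

noncomputable section

abbrev E3 : Type := EuclideanSpace ℝ (Fin 3)

def e1 : E3 := EuclideanSpace.single 0 1
def e2 : E3 := EuclideanSpace.single 1 1
def e3 : E3 := EuclideanSpace.single 2 1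

/-- First partial derivative of `u` in the first variable. -/
def pds (u : ℝ × ℝ → ℝ) (p : ℝ × ℝ) : ℝ := fderiv ℝ u p (1, 0)

/-- First partial derivative of `u` in the second variable. -/
def pdt (u : ℝ × ℝ → ℝ) (p : ℝ × ℝ) : ℝ := fderiv ℝ u p (0, 1)

/-- `S` is a translating graph in the direction of the unit vector `v`, with respect to the
orthonormal basis `(a, b, v)` of `ℝ³`, over the open connected domain `Ω ⊆ ℝ²`, given by the
smooth function `u : Ω → ℝ` solving the translator equation. -/
structure IsTranslatingGraph (a b v : E3) (Ω : Set (ℝ × ℝ)) (u : ℝ × ℝ → ℝ)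
    (S : Set E3) : Prop where
  norm_a : ‖a‖ = 1
  norm_b : ‖b‖ = 1
  norm_v : ‖v‖ = 1
  inner_ab : ⟪a, b⟫ = 0
  inner_av : ⟪a, v⟫ = 0
  inner_bv : ⟪b, v⟫ = 0
  isOpen_dom : IsOpen Ω
  isConnected_dom : IsConnected Ω
  smooth : ContDiffOn ℝ (⊤ : ℕ∞) u Ω
  pde : ∀ p ∈ Ω,
    (1 + (pdt u p) ^ 2) * pds (fun q => pds u q) p
      - 2 * pds u p * pdt u p * pdt (fun q => pds u q) p
      + (1 + (pds u p) ^ 2) * pdt (fun q => pdt u q) p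
    = (1 + (pds u p) ^ 2 + (pdt u p) ^ 2) *
        (⟪e3, v⟫ - pds u p * ⟪e3, a⟫ - pdt u p * ⟪e3, b⟫)
  graph_eq : S = {q : E3 | ∃ p ∈ Ω, q = p.1 • a + p.2 • b + u p • v}

/-- Entropy of a surface. -/
def entropy (S : Set E3) : ℝ≥0∞ :=
  ⨆ (x₀ : E3) (s₀ : ℝ) (_ : 0 < s₀),
    (ENNReal.ofReal (4 * π * s₀))⁻¹ *
      ∫⁻ q in S, ENNReal.ofReal (Real.exp (-‖q - x₀‖ ^ 2 / (4 * s₀))) ∂(μH[2])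

/-- Number of connected components (as a cardinal). -/
def numComponents (A : Set E3) : Cardinal := Cardinal.mk (ConnectedComponents A)

def vθ (θ : ℝ) : E3 := Real.sin θ • e3 + Real.cos θ • e2
def bθ (θ : ℝ) : E3 := Real.cos θ • e3 - Real.sin θ • e2


/-- The point of the translating graph over parameter `p`, for the basis `(e₁, b_θ, v_θ)`. -/
def graphPtθ (θ : ℝ) (u : ℝ × ℝ → ℝ) (p : ℝ × ℝ) : E3 :=
  p.1 • e1 + p.2 • bθ θ + u p • vθ θ

/-- The Gauss map of a translating graph in the direction `v_θ`, as a function of the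
parameter `p ∈ Ω`: `N = (v_θ − u_s e₁ − u_t b_θ)/√(1+u_s²+u_t²)`. -/
def gaussMapθ (θ : ℝ) (u : ℝ × ℝ → ℝ) (p : ℝ × ℝ) : E3 :=
  (Real.sqrt (1 + (pds u p) ^ 2 + (pdt u p) ^ 2))⁻¹ •
    (vθ θ - pds u p • e1 - pdt u p • bθ θ)

section Calculus

open Filter Topology Set
open scoped ContDiff

theorem contDiffOn_pds {Ω : Set (ℝ × ℝ)} {f : ℝ × ℝ → ℝ} (hΩ : IsOpen Ω)
    (hf : ContDiffOn ℝ ∞ f Ω) : ContDiffOn ℝ ∞ (pds f) Ω :=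
  (hf.fderiv_of_isOpen hΩ (by simp)).clm_apply contDiffOn_const

theorem contDiffOn_pdt {Ω : Set (ℝ × ℝ)} {f : ℝ × ℝ → ℝ} (hΩ : IsOpen Ω)
    (hf : ContDiffOn ℝ ∞ f Ω) : ContDiffOn ℝ ∞ (pdt f) Ω :=
  (hf.fderiv_of_isOpen hΩ (by simp)).clm_apply contDiffOn_const

theorem pds_neg (f : ℝ × ℝ → ℝ) : pds (fun p => -f p) = fun p => -pds f p := by
  funext p; simp [pds, fderiv_fun_neg]

theorem pdt_neg (f : ℝ × ℝ → ℝ) : pdt (fun p => -f p) = fun p => -pdt f p := by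
  funext p; simp [pdt, fderiv_fun_neg]

theorem pds_congr {Ω : Set (ℝ × ℝ)} {f g : ℝ × ℝ → ℝ} (hΩ : IsOpen Ω) (h : EqOn f g Ω)
    {p : ℝ × ℝ} (hp : p ∈ Ω) : pds f p = pds g p := by
  simp only [pds]
  rw [(h.eventuallyEq_of_mem (hΩ.mem_nhds hp)).fderiv_eq]

/-- Symmetry of the mixed second partial derivatives. -/
theorem pdt_pds_eq {Ω : Set (ℝ × ℝ)} {f : ℝ × ℝ → ℝ} (hΩ : IsOpen Ω)
    (hf : ContDiffOn ℝ ∞ f Ω) {p : ℝ × ℝ} (hp : p ∈ Ω) : pdt (pds f) p = pds (pdt f) p := by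
  have hd : DifferentiableAt ℝ (fderiv ℝ f) p :=
    ((hf.fderiv_of_isOpen (m := ∞) hΩ (by simp)).contDiffAt (hΩ.mem_nhds hp)).differentiableAt
      (by simp)
  have hsymm : IsSymmSndFDerivAt ℝ f p :=
    (hf.contDiffAt (hΩ.mem_nhds hp)).isSymmSndFDerivAt
      (by simp only [minSmoothness_of_isRCLikeNormedField]; exact ENat.LEInfty.out)
  have key : ∀ v w : ℝ × ℝ, fderiv ℝ (fun q => fderiv ℝ f q v) p w = fderiv ℝ (fderiv ℝ f) p w v := by
    intro v w
    rw [fderiv_clm_apply hd (differentiableAt_const v)]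
    simp
  change fderiv ℝ (fun q => fderiv ℝ f q (1, 0)) p (0, 1) =
    fderiv ℝ (fun q => fderiv ℝ f q (0, 1)) p (1, 0)
  rw [key, key]
  exact hsymm _ _

/-- The derivative along a line in terms of the partial derivatives. -/
theorem hasDerivAt_line {Ω : Set (ℝ × ℝ)} {f : ℝ × ℝ → ℝ} (hΩ : IsOpen Ω)
    (hf : ContDiffOn ℝ ∞ f Ω) (p : ℝ × ℝ) (x y r : ℝ) (hr : p + r • (x, y) ∈ Ω) :
    HasDerivAt (fun r : ℝ => f (p + r • (x, y)))
      (x * pds f (p + r • (x, y)) + y * pdt f (p + r • (x, y))) r := by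
  have hd : HasFDerivAt f (fderiv ℝ f (p + r • (x, y))) (p + r • (x, y)) :=
    ((hf.contDiffAt (hΩ.mem_nhds hr)).differentiableAt (by simp)).hasFDerivAt
  have hl : HasDerivAt (fun r : ℝ => p + r • (x, y)) (x, y) r := by
    simpa using ((hasDerivAt_id r).smul_const (x, y)).const_add p
  have h := hd.comp_hasDerivAt r hl
  have hxy : ((x, y) : ℝ × ℝ) = x • (1, 0) + y • (0, 1) := by simp
  have e : fderiv ℝ f (p + r • (x, y)) (x, y) =
      x * pds f (p + r • (x, y)) + y * pdt f (p + r • (x, y)) := by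
    conv_lhs => rw [show fderiv ℝ f (p + r • (x, y)) (x, y) =
      fderiv ℝ f (p + r • (x, y)) (x • (1, 0) + y • (0, 1)) from by rw [← hxy]]
    simp only [map_add, map_smul, smul_eq_mul, pds, pdt]
  rw [← e]
  exact h

theorem eventually_line_mem {Ω : Set (ℝ × ℝ)} (hΩ : IsOpen Ω) {p : ℝ × ℝ} (hp : p ∈ Ω)
    (x y : ℝ) : ∀ᶠ r : ℝ in 𝓝 0, p + r • (x, y) ∈ Ω := by
  have hc : Continuous (fun r : ℝ => p + r • (x, y)) := by fun_prop
  exact hc.continuousAt.eventually_mem (hΩ.mem_nhds (by simpa using hp))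

/-- First and second order necessary conditions at a local maximum of a function of one
variable. -/
theorem IsLocalMax.hasDerivAt_second_nonpos {h h₁ : ℝ → ℝ} {h₂ a : ℝ} (hmax : IsLocalMax h a)
    (hd : ∀ᶠ r in 𝓝 a, HasDerivAt h (h₁ r) r) (hd₁ : HasDerivAt h₁ h₂ a) :
    h₁ a = 0 ∧ h₂ ≤ 0 := by
  have h0 : h₁ a = 0 := hmax.hasDerivAt_eq_zero hd.self_of_nhds
  refine ⟨h0, ?_⟩
  by_contra! hpos
  have hderiv : deriv h =ᶠ[𝓝 a] h₁ := hd.mono fun r hr => hr.deriv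
  have hdd : deriv (deriv h) a = h₂ := by rw [hderiv.deriv_eq]; exact hd₁.deriv
  have hmin : IsLocalMin h a :=
    isLocalMin_of_deriv_deriv_pos (by rw [hdd]; exact hpos) (by rw [hderiv.self_of_nhds, h0])
      hd.self_of_nhds.continuousAt
  have hconst : h =ᶠ[𝓝 a] fun _ => h a := by
    filter_upwards [hmax, hmin] with r h1 h2 using le_antisymm h1 h2
  have hz : deriv h =ᶠ[𝓝 a] fun _ => 0 := by
    filter_upwards [hconst.eventuallyEq_nhds] with r hr
    rw [hr.deriv_eq]; simp
  have := hz.deriv_eq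
  rw [hdd] at this
  simp at this
  exact hpos.ne' this

/-- The second derivative along a line in terms of the partial derivatives. -/
theorem hasDerivAt_line_second {Ω : Set (ℝ × ℝ)} {f : ℝ × ℝ → ℝ} (hΩ : IsOpen Ω)
    (hf : ContDiffOn ℝ ∞ f Ω) {p : ℝ × ℝ} (hp : p ∈ Ω) (x y : ℝ) :
    HasDerivAt (fun r : ℝ => x * pds f (p + r • (x, y)) + y * pdt f (p + r • (x, y)))
      (x ^ 2 * pds (pds f) p + 2 * x * y * pdt (pds f) p + y ^ 2 * pdt (pdt f) p) 0 := by
  have hp' : p + (0 : ℝ) • (x, y) ∈ Ω := by simpa using hp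
  have h1 := (hasDerivAt_line hΩ (contDiffOn_pds hΩ hf) p x y 0 hp').const_mul x
  have h2 := (hasDerivAt_line hΩ (contDiffOn_pdt hΩ hf) p x y 0 hp').const_mul y
  refine (h1.add h2).congr_deriv ?_
  simp only [zero_smul, add_zero, ← pdt_pds_eq hΩ hf hp]
  ring

end Calculus

section MaximumPrinciple

open Filter Topology Set
open scoped ContDiff

/-- Weak maximum principle for linear elliptic operators without zeroth order term whose
principal part is the identity plus a rank one matrix. -/
theorem le_of_le_frontier_of_elliptic {Ω : Set (ℝ × ℝ)} {w η₁ η₂ β₁ β₂ : ℝ × ℝ → ℝ}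
    (hΩ : IsOpen Ω) (hw : ContDiffOn ℝ ∞ w Ω) (hβ : ContinuousOn β₁ Ω)
    (heq : ∀ p ∈ Ω, (1 + η₁ p ^ 2) * pds (pds w) p + 2 * η₁ p * η₂ p * pdt (pds w) p
      + (1 + η₂ p ^ 2) * pdt (pdt w) p + β₁ p * pds w p + β₂ p * pdt w p = 0)
    {D : Set (ℝ × ℝ)} (hD : IsOpen D) (hcpt : IsCompact (closure D)) (hDΩ : closure D ⊆ Ω)
    {m : ℝ} (hm : ∀ p ∈ frontier D, w p ≤ m) : ∀ p ∈ D, w p ≤ m := by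
  intro p hp
  by_contra! hlt
  have hne : (closure D).Nonempty := ⟨p, subset_closure hp⟩
  obtain ⟨q₁, -, hq₁⟩ := hcpt.exists_isMinOn hne (hβ.mono hDΩ)
  set l : ℝ := |β₁ q₁| + 1 with hl
  have hlpos : 0 < l := by positivity
  have hlb : ∀ q ∈ closure D, 0 < l + β₁ q := by
    intro q hq
    have h1 : β₁ q₁ ≤ β₁ q := hq₁ hq
    have h2 := neg_abs_le (β₁ q₁)
    linarith
  have hexp : Continuous (fun q : ℝ × ℝ => Real.exp (l * q.1)) := by fun_prop
  obtain ⟨q₂, -, hq₂⟩ := hcpt.exists_isMaxOn hne hexp.continuousOn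
  set B : ℝ := Real.exp (l * q₂.1) with hB
  have hBpos : 0 < B := Real.exp_pos _
  set ε : ℝ := (w p - m) / (2 * B) with hε
  have hεpos : 0 < ε := div_pos (by linarith) (by positivity)
  have hεB : ε * B = (w p - m) / 2 := by rw [hε]; field_simp
  have hcont : ContinuousOn (fun q : ℝ × ℝ => w q + ε * Real.exp (l * q.1)) (closure D) :=
    (hw.continuousOn.mono hDΩ).add (by fun_prop)
  obtain ⟨q, hq, hqmax⟩ := hcpt.exists_isMaxOn hne hcont
  have hqp : w p + ε * Real.exp (l * p.1) ≤ w q + ε * Real.exp (l * q.1) :=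
    hqmax (subset_closure hp)
  have hqD : q ∈ D := by
    by_contra hqD
    have hfr : q ∈ frontier D := ⟨hq, by rwa [hD.interior_eq]⟩
    have h1 := hm q hfr
    have h2 : ε * Real.exp (l * q.1) ≤ ε * B := mul_le_mul_of_nonneg_left (hq₂ hq) hεpos.le
    have h3 : 0 < ε * Real.exp (l * p.1) := mul_pos hεpos (Real.exp_pos _)
    linarith
  have hqΩ : q ∈ Ω := hDΩ hq
  set X : ℝ := ε * Real.exp (l * q.1) with hX
  have hXpos : 0 < X := mul_pos hεpos (Real.exp_pos _)
  have key : ∀ x y : ℝ, x * pds w q + y * pdt w q + X * (l * x) = 0 ∧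
      x ^ 2 * pds (pds w) q + 2 * x * y * pdt (pds w) q + y ^ 2 * pdt (pdt w) q
        + X * (l * x) ^ 2 ≤ 0 := by
    intro x y
    have hloc : IsLocalMax (fun r : ℝ => w (q + r • (x, y)) + ε * Real.exp (l * (q.1 + r * x)))
        0 := by
      filter_upwards [eventually_line_mem hD hqD x y] with r hr
      have := hqmax (subset_closure hr)
      simpa using this
    have hE : ∀ r : ℝ, HasDerivAt (fun r : ℝ => ε * Real.exp (l * (q.1 + r * x)))
        (ε * Real.exp (l * (q.1 + r * x)) * (l * x)) r := by
      intro r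
      have h := ((((hasDerivAt_id r).mul_const x).const_add q.1).const_mul l).exp.const_mul ε
      refine h.congr_deriv ?_
      simp only [id]
      ring
    have hd : ∀ᶠ r in 𝓝 (0 : ℝ), HasDerivAt
        (fun r : ℝ => w (q + r • (x, y)) + ε * Real.exp (l * (q.1 + r * x)))
        (x * pds w (q + r • (x, y)) + y * pdt w (q + r • (x, y))
          + ε * Real.exp (l * (q.1 + r * x)) * (l * x)) r := by
      filter_upwards [eventually_line_mem hΩ hqΩ x y] with r hr
      exact (hasDerivAt_line hΩ hw q x y r hr).add (hE r)
    have hd1 := (hasDerivAt_line_second hΩ hw hqΩ x y).add ((hE 0).mul_const (l * x))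
    have := hloc.hasDerivAt_second_nonpos hd hd1
    simp only [zero_smul, add_zero, zero_mul] at this
    refine ⟨this.1, le_trans (le_of_eq ?_) this.2⟩
    rw [hX]; ring
  have hs := (key 1 0).1
  have ht := (key 0 1).1
  have h1 := (key 1 0).2
  have h2 := (key 0 1).2
  have h3 := (key (η₁ q) (η₂ q)).2
  have h4 := heq q hqΩ
  have hs' : pds w q = -(X * l) := by linarith
  have ht' : pdt w q = 0 := by linarith
  rw [hs', ht'] at h4
  have h5 : 0 < X * l * (l + β₁ q) := mul_pos (mul_pos hXpos hlpos) (hlb q hq)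
  have h6 : 0 ≤ X * (l * η₁ q) ^ 2 := by positivity
  nlinarith

/-- Weak minimum principle, the counterpart of `le_of_le_frontier_of_elliptic`. -/
theorem le_of_frontier_le_of_elliptic {Ω : Set (ℝ × ℝ)} {w η₁ η₂ β₁ β₂ : ℝ × ℝ → ℝ}
    (hΩ : IsOpen Ω) (hw : ContDiffOn ℝ ∞ w Ω) (hβ : ContinuousOn β₁ Ω)
    (heq : ∀ p ∈ Ω, (1 + η₁ p ^ 2) * pds (pds w) p + 2 * η₁ p * η₂ p * pdt (pds w) p
      + (1 + η₂ p ^ 2) * pdt (pdt w) p + β₁ p * pds w p + β₂ p * pdt w p = 0)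
    {D : Set (ℝ × ℝ)} (hD : IsOpen D) (hcpt : IsCompact (closure D)) (hDΩ : closure D ⊆ Ω)
    {m : ℝ} (hm : ∀ p ∈ frontier D, m ≤ w p) : ∀ p ∈ D, m ≤ w p := by
  intro p hp
  have := le_of_le_frontier_of_elliptic (w := fun p => -w p) (η₁ := η₁) (η₂ := η₂) (β₁ := β₁)
    (β₂ := β₂) hΩ hw.neg hβ
    (by
      intro p hp
      simp only [pds_neg, pdt_neg]
      linarith [heq p hp])
    hD hcpt hDΩ (m := -m) (fun p hp => by simpa using hm p hp) p hp
  linarith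

end MaximumPrinciple

section TranslatorEquation

open Filter Topology Set
open scoped ContDiff

/-- The translator equation `(1+u_t²)u_ss − 2u_su_tu_st + (1+u_s²)u_tt = (1+|∇u|²)(σ − c u_t)`
on `Ω`. -/
def SolvesTranslatorEq (σ c : ℝ) (Ω : Set (ℝ × ℝ)) (u : ℝ × ℝ → ℝ) : Prop :=
  ∀ p ∈ Ω, (1 + pdt u p ^ 2) * pds (pds u) p - 2 * pds u p * pdt u p * pdt (pds u) p
    + (1 + pds u p ^ 2) * pdt (pdt u) p
      = (1 + pds u p ^ 2 + pdt u p ^ 2) * (σ - c * pdt u p)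

theorem SolvesTranslatorEq.neg {σ c : ℝ} {Ω : Set (ℝ × ℝ)} {u : ℝ × ℝ → ℝ}
    (h : SolvesTranslatorEq σ c Ω u) : SolvesTranslatorEq (-σ) c Ω (fun p => -u p) := by
  intro p hp
  simp only [pds_neg, pdt_neg]
  linear_combination -(h p hp)

/-- The equation satisfied by `u_t`, obtained by differentiating the translator equation. -/
theorem SolvesTranslatorEq.pdt_eq {σ c : ℝ} {Ω : Set (ℝ × ℝ)} {u : ℝ × ℝ → ℝ}
    (hΩ : IsOpen Ω) (hu : ContDiffOn ℝ ∞ u Ω) (h : SolvesTranslatorEq σ c Ω u) :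
    ∀ p ∈ Ω, (1 + pdt u p ^ 2) * pds (pds (pdt u)) p
      + 2 * pdt u p * (-pds u p) * pdt (pds (pdt u)) p
      + (1 + (-pds u p) ^ 2) * pdt (pdt (pdt u)) p
      + (-2 * pdt u p * pdt (pds u) p + 2 * pds u p * pdt (pdt u) p
          - 2 * pds u p * (σ - c * pdt u p)) * pds (pdt u) p
      + (2 * pdt u p * pds (pds u) p - 2 * pds u p * pdt (pds u) p
          - 2 * pdt u p * (σ - c * pdt u p)
          + c * (1 + pds u p ^ 2 + pdt u p ^ 2)) * pdt (pdt u) p = 0 := by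
  intro p hp
  have hus := contDiffOn_pds hΩ hu
  have hut := contDiffOn_pdt hΩ hu
  have line : ∀ {f : ℝ × ℝ → ℝ}, ContDiffOn ℝ ∞ f Ω →
      HasDerivAt (fun r : ℝ => f (p + r • (0, 1))) (pdt f p) 0 := by
    intro f hf
    simpa using hasDerivAt_line hΩ hf p 0 1 0 (by simpa using hp)
  have d1 := line hus
  have d2 := line hut
  have d11 := line (contDiffOn_pds hΩ hus)
  have d12 := line (contDiffOn_pdt hΩ hus)
  have d22 := line (contDiffOn_pdt hΩ hut)
  have hL := (((d2.pow 2).const_add 1).mul d11).sub (((d1.const_mul 2).mul d2).mul d12)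
    |>.add (((d1.pow 2).const_add 1).mul d22)
  have hR := ((((d1.pow 2).const_add 1).add (d2.pow 2))).mul ((d2.const_mul c).const_sub σ)
  have hcongr := hR.congr_of_eventuallyEq (f₁ := _)
    ((eventually_line_mem hΩ hp 0 1).mono fun r hr => h _ hr)
  have huniq := hL.unique hcongr
  have s1 : pdt (pds (pds u)) p = pds (pds (pdt u)) p := by
    rw [pdt_pds_eq hΩ hus hp]
    exact pds_congr hΩ (fun q hq => pdt_pds_eq hΩ hu hq) hp
  have s2 : pdt (pdt (pds u)) p = pdt (pds (pdt u)) p := by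
    simp only [pdt]
    rw [(EqOn.eventuallyEq_of_mem (fun q hq => pdt_pds_eq hΩ hu hq)
      (hΩ.mem_nhds hp)).fderiv_eq]
  have s3 : pdt (pds u) p = pds (pdt u) p := pdt_pds_eq hΩ hu hp
  have hz : p + ((0, 0) : ℝ × ℝ) = p := add_zero p
  simp [s1, s2, hz] at huniq
  rw [← s3]
  linear_combination huniq

end TranslatorEquation

section Filling

open Filter Topology Set
open scoped ContDiff

/-- Barrier estimate: a solution of the translator equation is bounded above, after subtracting a
linear function, on the part of a bounded region lying strictly beyond all the gaps of its
domain. -/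
theorem SolvesTranslatorEq.exists_upper_bound {σ c : ℝ} (hc : c ≠ 0) {Ω : Set (ℝ × ℝ)}
    {u : ℝ × ℝ → ℝ} (hΩ : IsOpen Ω) (hu : ContDiffOn ℝ ∞ u Ω) (h : SolvesTranslatorEq σ c Ω u)
    {D : Set (ℝ × ℝ)} (hD : IsOpen D) (hcpt : IsCompact (closure D)) (hfr : frontier D ⊆ Ω)
    {a : ℝ} (ha : ∀ p ∈ closure D, a < c * p.2 → p ∈ Ω) :
    ∃ B : ℝ, ∀ p ∈ D, a < c * p.2 → c * u p - σ * p.2 ≤ B := by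
  set Y : ℝ × ℝ → ℝ := fun p => c * u p - σ * p.2 with hY
  have hYc : ContinuousOn Y Ω := (continuousOn_const.mul hu.continuousOn).sub (by fun_prop)
  have hfc : IsCompact (frontier D) := hcpt.of_isClosed_subset isClosed_frontier
    frontier_subset_closure
  obtain ⟨M, hM⟩ := hfc.bddAbove_image (hYc.mono hfr)
  have hM' : ∀ p ∈ frontier D, Y p ≤ M := fun p hp => hM (mem_image_of_mem _ hp)
  obtain ⟨δ₀, hδ₀⟩ := hcpt.bddAbove_image
    (f := fun p : ℝ × ℝ => c * p.2 - a) (by fun_prop)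
  set δ : ℝ := |δ₀| with hδ
  have hδ' : ∀ p ∈ closure D, c * p.2 - a ≤ δ := fun p hp =>
    (hδ₀ (mem_image_of_mem _ hp)).trans (le_abs_self _)
  have hc2 : 0 < c ^ 2 := by positivity
  have hcs : 0 < c ^ 2 + σ ^ 2 := by positivity
  set k : ℝ := c ^ 2 / (8 * (c ^ 2 + σ ^ 2)) with hk
  have hkpos : 0 < k := by positivity
  have hk8 : 8 * k * (c ^ 2 + σ ^ 2) = c ^ 2 := by rw [hk]; field_simp
  set K : ℝ := δ / k + 1 with hK
  have hK1 : 1 ≤ K := by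
    have : 0 ≤ δ / k := div_nonneg (abs_nonneg _) hkpos.le
    linarith
  have hkK : δ ≤ k * K ^ 2 := by
    have h1 : k * K = δ + k := by rw [hK]; field_simp
    have h2 : (δ + k) * 1 ≤ (δ + k) * K :=
      mul_le_mul_of_nonneg_left hK1 (add_nonneg (abs_nonneg _) hkpos.le)
    have h3 : k * K ^ 2 = (δ + k) * K := by rw [← h1]; ring
    linarith
  set B : ℝ := M + K with hB
  refine ⟨B, fun p hp hpa => ?_⟩
  by_contra! hpB
  change B < Y p at hpB
  set φ : ℝ × ℝ → ℝ := fun q => c * q.2 - k * (max (B - Y q) 0) ^ 2 with hφ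
  set e : ℝ := (a + c * p.2) / 2 with he
  set L : Set (ℝ × ℝ) := {q | q ∈ closure D ∧ e ≤ c * q.2} with hL
  have hLcpt : IsCompact L :=
    hcpt.inter_right (isClosed_le (f := fun _ : ℝ × ℝ => e) (g := fun q : ℝ × ℝ => c * q.2)
      continuous_const (by fun_prop))
  have hLΩ : L ⊆ Ω := fun q hq => ha q hq.1 (by have := hq.2; linarith)
  have hφc : ContinuousOn φ L := by
    have h1 : ContinuousOn (fun q => max (B - Y q) 0) L :=
      (continuousOn_const.sub (hYc.mono hLΩ)).sup continuousOn_const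
    exact ContinuousOn.sub (by fun_prop) (continuousOn_const.mul (h1.pow 2))
  have hpL : p ∈ L := ⟨subset_closure hp, by linarith⟩
  obtain ⟨q, hq, hqmax⟩ := hLcpt.exists_isMaxOn ⟨p, hpL⟩ hφc
  have hφp : φ p = c * p.2 := by
    simp only [hφ]
    rw [max_eq_right (by linarith)]; ring
  have hqp : c * p.2 ≤ φ q := by rw [← hφp]; exact hqmax hpL
  have hqφ : φ q ≤ c * q.2 := by
    simp only [hφ]
    have : 0 ≤ k * (max (B - Y q) 0) ^ 2 := by positivity
    linarith
  have hqD : q ∈ D := by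
    by_contra hqD
    have h1 := hM' q ⟨hq.1, by rwa [hD.interior_eq]⟩
    have h2 : K ≤ max (B - Y q) 0 := le_trans (by linarith) (le_max_left _ _)
    have h3 : k * K ^ 2 ≤ k * (max (B - Y q) 0) ^ 2 := by gcongr
    have h4 := hδ' q hq.1
    have h5 : φ q = c * q.2 - k * (max (B - Y q) 0) ^ 2 := rfl
    linarith
  have hqΩ : q ∈ Ω := hLΩ hq
  have hUopen : IsOpen (D ∩ {q : ℝ × ℝ | e < c * q.2}) :=
    hD.inter (isOpen_lt continuous_const (by fun_prop))
  have hqU : q ∈ D ∩ {q : ℝ × ℝ | e < c * q.2} :=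
    ⟨hqD, by simp only [mem_ofPred_eq]; linarith⟩
  have hUL : D ∩ {q : ℝ × ℝ | e < c * q.2} ⊆ L := fun z hz => ⟨subset_closure hz.1, le_of_lt hz.2⟩
  rcases lt_or_ge B (Y q) with hBq | hBq
  · have hev : ∀ᶠ r : ℝ in 𝓝 0, c * (q.2 + r * 1) ≤ c * (q.2 + 0 * 1) := by
      have hBopen : IsOpen (Ω ∩ Y ⁻¹' Ioi B) := hYc.isOpen_inter_preimage hΩ isOpen_Ioi
      filter_upwards [eventually_line_mem hUopen hqU 0 1,
        eventually_line_mem hBopen ⟨hqΩ, hBq⟩ 0 1] with r h1 h2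
      have h3 : φ (q + r • (0, 1)) ≤ φ q := hqmax (hUL h1)
      have h4 : φ (q + r • (0, 1)) = c * (q.2 + r * 1) := by
        have h5 : B < Y (q + r • (0, 1)) := h2.2
        simp only [hφ]
        rw [max_eq_right (by linarith)]
        simp
      rw [h4] at h3
      linarith
    have hd : HasDerivAt (fun r : ℝ => c * (q.2 + r * 1)) c 0 := by
      simpa using (((hasDerivAt_id (0 : ℝ)).mul_const 1).const_add q.2).const_mul c
    exact hc (IsLocalMax.hasDerivAt_eq_zero (f := fun r : ℝ => c * (q.2 + r * 1)) hev hd)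
  · set N : ℝ := 2 * k * (B - Y q) with hN
    have key : ∀ x y : ℝ,
        c * y + N * (c * (x * pds u q + y * pdt u q) - σ * y) = 0 ∧
        N * (c * (x ^ 2 * pds (pds u) q + 2 * x * y * pdt (pds u) q + y ^ 2 * pdt (pdt u) q))
          - 2 * k * (c * (x * pds u q + y * pdt u q) - σ * y) ^ 2 ≤ 0 := by
      intro x y
      have hloc : IsLocalMax (fun r : ℝ => c * (q.2 + r * y)
          - k * (B - (c * u (q + r • (x, y)) - σ * (q.2 + r * y))) ^ 2) 0 := by
        filter_upwards [eventually_line_mem hUopen hqU x y] with r hr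
        have h1 : φ (q + r • (x, y)) ≤ φ q := hqmax (hUL hr)
        have h2 : φ q = c * q.2 - k * (B - Y q) ^ 2 := by
          simp only [hφ]
          rw [max_eq_left (by linarith)]
        have h3 : c * (q + r • (x, y)).2 - k * (B - Y (q + r • (x, y))) ^ 2 ≤ φ (q + r • (x, y)) := by
          simp only [hφ]
          have : (max (B - Y (q + r • (x, y))) 0) ^ 2 ≤ (B - Y (q + r • (x, y))) ^ 2 := by
            rcases le_total (B - Y (q + r • (x, y))) 0 with h | h
            · rw [max_eq_right h]; simpa using sq_nonneg _
            · rw [max_eq_left h]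
          have := mul_le_mul_of_nonneg_left this hkpos.le
          linarith
        have h4 := h3.trans (h1.trans h2.le)
        simpa [hY] using h4
      have hlin : ∀ r : ℝ, HasDerivAt (fun r : ℝ => q.2 + r * y) y r := by
        intro r
        simpa using ((hasDerivAt_id r).mul_const y).const_add q.2
      have hYd : ∀ r : ℝ, q + r • (x, y) ∈ Ω → HasDerivAt
          (fun r : ℝ => B - (c * u (q + r • (x, y)) - σ * (q.2 + r * y)))
          (-(c * (x * pds u (q + r • (x, y)) + y * pdt u (q + r • (x, y))) - σ * y)) r :=
        fun r hr => (((hasDerivAt_line hΩ hu q x y r hr).const_mul c).sub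
          ((hlin r).const_mul σ)).const_sub B
      have hd : ∀ᶠ r in 𝓝 (0 : ℝ), HasDerivAt (fun r : ℝ => c * (q.2 + r * y)
          - k * (B - (c * u (q + r • (x, y)) - σ * (q.2 + r * y))) ^ 2)
          (c * y + 2 * k * ((B - (c * u (q + r • (x, y)) - σ * (q.2 + r * y)))
            * (c * (x * pds u (q + r • (x, y)) + y * pdt u (q + r • (x, y))) - σ * y))) r := by
        filter_upwards [eventually_line_mem hΩ hqΩ x y] with r hr
        refine (((hlin r).const_mul c).sub (((hYd r hr).pow 2).const_mul k)).congr_deriv ?_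
        simp only [Nat.cast_ofNat, Nat.add_one_sub_one, pow_one]
        ring
      have hq0 : q + (0 : ℝ) • (x, y) ∈ Ω := by simpa using hqΩ
      have hd1 := (((hYd 0 hq0).mul (((hasDerivAt_line_second hΩ hu hqΩ x y).const_mul c).sub_const
        (σ * y))).const_mul (2 * k)).const_add (c * y)
      have := hloc.hasDerivAt_second_nonpos hd hd1
      simp only [zero_smul, add_zero, zero_mul] at this
      refine ⟨?_, ?_⟩
      · rw [hN]; linear_combination this.1
      · rw [hN]
        simp only [hY]
        linarith [this.2]
    have hs := (key 1 0).1
    have ht := (key 0 1).1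
    have hN0 : N ≠ 0 := by
      intro h0
      rw [h0] at ht
      exact hc (by linarith)
    have hus : pds u q = 0 := by
      have : N * c * pds u q = 0 := by linarith
      simpa [hN0, hc] using this
    have h1 := (key 1 0).2
    have h2 := (key 0 1).2
    have h3 := (key (pdt u q) (-pds u q)).2
    have hpde := h q hqΩ
    rw [hus] at hpde h1 h2 h3
    have h4 : N * (σ - c * pdt u q) = c := by linarith
    have h5 : N * c * ((1 + pdt u q ^ 2) * (σ - c * pdt u q))
        - 2 * k * (c * pdt u q - σ) ^ 2 ≤ 0 := by
      have h6 : (1 + pdt u q ^ 2) * (σ - c * pdt u q)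
          = (1 + pdt u q ^ 2) * pds (pds u) q + pdt (pdt u) q := by linarith
      rw [h6]
      linarith
    have h6 : c ^ 2 * (1 + pdt u q ^ 2) ≤ 2 * k * (c * pdt u q - σ) ^ 2 := by
      have : N * c * ((1 + pdt u q ^ 2) * (σ - c * pdt u q)) = c ^ 2 * (1 + pdt u q ^ 2) := by
        linear_combination c * (1 + pdt u q ^ 2) * h4
      linarith
    have h7 : (c * pdt u q - σ) ^ 2 ≤ 2 * (c ^ 2 + σ ^ 2) * (1 + pdt u q ^ 2) := by
      have e : 2 * (c ^ 2 + σ ^ 2) * (1 + pdt u q ^ 2) - (c * pdt u q - σ) ^ 2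
          = (c * pdt u q + σ) ^ 2 + 2 * c ^ 2 + 2 * (σ * pdt u q) ^ 2 := by ring
      have : 0 ≤ (c * pdt u q + σ) ^ 2 + 2 * c ^ 2 + 2 * (σ * pdt u q) ^ 2 := by positivity
      linarith only [e, this]
    have h8 : 2 * k * (c * pdt u q - σ) ^ 2
        ≤ 2 * k * (2 * (c ^ 2 + σ ^ 2) * (1 + pdt u q ^ 2)) := by gcongr
    have h9 : 2 * k * (2 * (c ^ 2 + σ ^ 2) * (1 + pdt u q ^ 2))
        = c ^ 2 / 2 * (1 + pdt u q ^ 2) := by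
      linear_combination (1 + pdt u q ^ 2) / 2 * hk8
    have h10 : 0 < c ^ 2 * (1 + pdt u q ^ 2) := by positivity
    linarith

/-- The domain of a complete translating graph has no bounded gaps. -/
theorem SolvesTranslatorEq.closure_subset {σ c : ℝ} (hc : c ≠ 0) {Ω : Set (ℝ × ℝ)}
    {u : ℝ × ℝ → ℝ} (hΩ : IsOpen Ω) (hu : ContDiffOn ℝ ∞ u Ω) (h : SolvesTranslatorEq σ c Ω u)
    (hclosed : ∀ B : ℝ, IsClosed {p | p ∈ Ω ∧ |u p| ≤ B})
    {D : Set (ℝ × ℝ)} (hD : IsOpen D) (hcpt : IsCompact (closure D)) (hfr : frontier D ⊆ Ω) :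
    closure D ⊆ Ω := by
  by_contra hnot
  have hne : (closure D \ Ω).Nonempty := sdiff_nonempty.2 hnot
  have hEc : IsCompact (closure D \ Ω) := hcpt.diff hΩ
  obtain ⟨p₀, hp₀, hmax⟩ := hEc.exists_isMaxOn hne
    (f := fun p : ℝ × ℝ => c * p.2) (by fun_prop)
  have hp₀D : p₀ ∈ D := by
    by_contra hp
    exact hp₀.2 (hfr ⟨hp₀.1, by rwa [hD.interior_eq]⟩)
  have ha : ∀ p ∈ closure D, c * p₀.2 < c * p.2 → p ∈ Ω := by
    intro p hp hlt
    by_contra hpΩ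
    exact absurd (hmax ⟨hp, hpΩ⟩) (not_le.2 hlt)
  obtain ⟨B₁, hB₁⟩ := h.exists_upper_bound hc hΩ hu hD hcpt hfr ha
  obtain ⟨B₂, hB₂⟩ := h.neg.exists_upper_bound hc hΩ hu.neg hD hcpt hfr ha
  obtain ⟨T, hT⟩ := hcpt.bddAbove_image (f := fun p : ℝ × ℝ => |σ * p.2|) (by fun_prop)
  set B : ℝ := (max B₁ B₂ + T) / |c| with hB
  have hcabs : 0 < |c| := abs_pos.2 hc
  have hev : ∀ᶠ r : ℝ in 𝓝[>] 0, p₀ + r • (0, c) ∈ {p | p ∈ Ω ∧ |u p| ≤ B} := by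
    filter_upwards [(eventually_line_mem hD hp₀D 0 c).filter_mono nhdsWithin_le_nhds,
      self_mem_nhdsWithin] with r hr hr0
    have hrpos : 0 < r := hr0
    have hlt : c * p₀.2 < c * (p₀ + r • ((0 : ℝ), c)).2 := by
      have : 0 < r * c ^ 2 := by positivity
      simp only [Prod.snd_add, Prod.smul_snd, smul_eq_mul]
      nlinarith
    have h1 := hB₁ _ hr hlt
    have h2 := hB₂ _ hr hlt
    have h3 : |σ * (p₀ + r • ((0 : ℝ), c)).2| ≤ T := hT (mem_image_of_mem _ (subset_closure hr))
    refine ⟨ha _ (subset_closure hr) hlt, ?_⟩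
    rw [hB, le_div_iff₀ hcabs, mul_comm, ← abs_mul]
    have h4 := abs_le.1 h3
    have h5 := le_max_left B₁ B₂
    have h6 := le_max_right B₁ B₂
    exact abs_le.2 ⟨by linarith, by linarith⟩
  have hlim : Tendsto (fun r : ℝ => p₀ + r • ((0 : ℝ), c)) (𝓝[>] 0) (𝓝 p₀) := by
    have hcont : Continuous (fun r : ℝ => p₀ + r • ((0 : ℝ), c)) := by fun_prop
    have := hcont.tendsto 0
    simp only [zero_smul, add_zero] at this
    exact this.mono_left nhdsWithin_le_nhds
  exact hp₀.2 ((hclosed B).mem_of_tendsto hlim hev).1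

end Filling

section PlaneTopology

open Filter Topology Set

/-- A compact connected component of a relatively closed subset `Z` of an open set is contained in
a compact subset of `Z` that is isolated in `Z`. -/
theorem exists_isolated_of_isCompact_connectedComponentIn {X : Type*} [TopologicalSpace X]
    [T2Space X] [LocallyCompactSpace X] {Ω Z : Set X} (hΩ : IsOpen Ω) (hZΩ : Z ⊆ Ω)
    (hZ : ∀ C ⊆ Ω, IsClosed C → IsClosed (Z ∩ C)) {p : X} (hp : p ∈ Z)
    (hcpt : IsCompact (connectedComponentIn Z p)) :
    ∃ V : Set X, IsOpen V ∧ p ∈ V ∧ IsCompact (closure V) ∧ closure V ⊆ Ω ∧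
      Z ∩ closure V ⊆ V := by
  obtain ⟨U, hU, hKU, hUΩ, hUc⟩ := exists_open_between_and_isCompact_closure hcpt hΩ
    ((connectedComponentIn_subset Z p).trans hZΩ)
  have hpU : p ∈ U := hKU (mem_connectedComponentIn hp)
  set Y : Set X := Z ∩ closure U with hY
  have hYc : IsCompact Y :=
    hUc.of_isClosed_subset (hZ _ hUΩ isClosed_closure) inter_subset_right
  have hpY : p ∈ Y := ⟨hp, subset_closure hpU⟩
  have : CompactSpace Y := isCompact_iff_compactSpace.1 hYc
  have hcomp : connectedComponent (⟨p, hpY⟩ : Y) ⊆ (Subtype.val ⁻¹' U : Set Y) := by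
    intro y hy
    apply hKU
    have h1 : IsPreconnected (Subtype.val '' connectedComponent (⟨p, hpY⟩ : Y)) :=
      isPreconnected_connectedComponent.image _ continuous_subtype_val.continuousOn
    refine h1.subset_connectedComponentIn ⟨_, mem_connectedComponent, rfl⟩ ?_ ⟨y, hy, rfl⟩
    rintro _ ⟨z, -, rfl⟩
    exact z.2.1
  rw [connectedComponent_eq_iInter_isClopen] at hcomp
  have : Nonempty {s : Set Y // IsClopen s ∧ (⟨p, hpY⟩ : Y) ∈ s} :=
    ⟨⟨univ, isClopen_univ, mem_univ _⟩⟩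
  obtain ⟨C, hC⟩ := exists_subset_nhds_of_isCompact'
    (V := fun s : {s : Set Y // IsClopen s ∧ (⟨p, hpY⟩ : Y) ∈ s} => (s : Set Y))
    (fun s t => ⟨⟨s.1 ∩ t.1, s.2.1.inter t.2.1, s.2.2, t.2.2⟩, inter_subset_left,
      inter_subset_right⟩)
    (fun s => s.2.1.isClosed.isCompact) (fun s => s.2.1.isClosed)
    (U := (Subtype.val ⁻¹' U : Set Y))
    (fun x hx => (hU.preimage continuous_subtype_val).mem_nhds (hcomp hx))
  obtain ⟨O, hO, hOC⟩ := isOpen_induced_iff.1 C.2.1.isOpen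
  have hZ1c : IsCompact (Subtype.val '' (C : Set Y)) :=
    C.2.1.isClosed.isCompact.image continuous_subtype_val
  have hZ1 : Subtype.val '' (C : Set Y) ⊆ O ∩ U := by
    rintro _ ⟨z, hz, rfl⟩
    refine ⟨?_, hC hz⟩
    rw [← hOC] at hz
    exact hz
  obtain ⟨V, hV, hZ1V, hVO, hVc⟩ :=
    exists_open_between_and_isCompact_closure hZ1c (hO.inter hU) hZ1
  refine ⟨V, hV, hZ1V ⟨_, C.2.2, rfl⟩, hVc,
    fun z hz => hUΩ (subset_closure (hVO hz).2), ?_⟩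
  rintro z ⟨hzZ, hzV⟩
  apply hZ1V
  refine ⟨⟨z, hzZ, subset_closure (hVO hzV).2⟩, ?_, rfl⟩
  rw [← hOC]
  exact (hVO hzV).1

theorem isPreconnected_compl_closedBall {E : Type*} [NormedAddCommGroup E] [NormedSpace ℝ E]
    (h : 1 < Module.rank ℝ E) {R : ℝ} (hR : 0 ≤ R) :
    IsPreconnected ((closedBall (0 : E) R)ᶜ) := by
  have h1 : IsPreconnected (Ioi R ×ˢ sphere (0 : E) 1) :=
    isPreconnected_Ioi.prod (isPreconnected_sphere h 0 1)
  have h2 := h1.image (fun z : ℝ × E => z.1 • z.2) (by fun_prop)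
  convert h2 using 1
  ext x
  simp only [mem_compl_iff, mem_closedBall, dist_zero_right, not_le, mem_image, mem_prod, mem_Ioi,
    mem_sphere, Prod.exists]
  constructor
  · intro hx
    have hx0 : ‖x‖ ≠ 0 := (hR.trans_lt hx).ne'
    exact ⟨‖x‖, ‖x‖⁻¹ • x, ⟨hx, by simp [norm_smul, hx0]⟩, by simp [smul_smul, hx0]⟩
  · rintro ⟨r, y, ⟨hr, hy⟩, rfl⟩
    rw [norm_smul, hy, mul_one, Real.norm_eq_abs]
    exact hr.trans_le (le_abs_self r)

theorem eventually_eq_of_continuousAt_of_int {X : Type*} [TopologicalSpace X] {g : X → ℝ} {x : X}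
    (hg : ContinuousAt g x) (hint : ∀ y, ∃ n : ℤ, g y = n) : ∀ᶠ y in 𝓝 x, g y = g x := by
  filter_upwards [hg.eventually (Metric.ball_mem_nhds (g x) one_pos)] with y hy
  obtain ⟨n, hn⟩ := hint y
  obtain ⟨m, hm⟩ := hint x
  rw [hn, hm, Real.dist_eq] at hy
  rw [hn, hm]
  have : |n - m| < 1 := by exact_mod_cast hy
  rw [Int.abs_lt_one_iff] at this
  rw [sub_eq_zero.1 this]

/-- A form of the unicoherence of the plane: if a closed set `Z` does not enclose any bounded
open set, then a relatively clopen splitting of `V \ Z` for a neighbourhood `V` of `Z` extends to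
a splitting of `V`. -/
theorem exists_isOpen_splitting {Z V A B : Set (ℝ × ℝ)}
    (hA : IsOpen A) (hB : IsOpen B) (hV : IsOpen V) (hVc : IsCompact (closure V))
    (hZ : IsClosed Z) (hAB : Disjoint A B) (hAZ : Disjoint A Z) (hBZ : Disjoint B Z)
    (hVeq : V = A ∪ B ∪ Z)
    (hfill : ∀ D : Set (ℝ × ℝ), IsOpen D → IsCompact (closure D) → frontier D ⊆ Z →
      Disjoint D Z → D = ∅) :
    ∃ P Q : Set (ℝ × ℝ), IsOpen P ∧ IsOpen Q ∧ Disjoint P Q ∧ P ∪ Q = V ∧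
      Disjoint P B ∧ Disjoint Q A := by
  classical
  have hAV : A ⊆ V := by rw [hVeq]; exact fun x hx => Or.inl (Or.inl hx)
  have hBV : B ⊆ V := by rw [hVeq]; exact fun x hx => Or.inl (Or.inr hx)
  have hZV : Z ⊆ V := by rw [hVeq]; exact fun x hx => Or.inr hx
  obtain ⟨ρ, hρ0, hρ1, -⟩ := exists_continuous_zero_one_of_isClosed hV.isClosed_compl hZ
    (disjoint_compl_left_iff_subset.2 hZV)
  have hfrA : ∀ p ∈ frontier A, p ∈ Z ∨ ρ p = 0 := by
    intro p hp
    by_cases hpV : p ∈ V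
    · rw [hVeq] at hpV
      rcases hpV with (h | h) | h
      · exact absurd hp (by rw [hA.frontier_eq]; exact fun h' => h'.2 h)
      · exact absurd (frontier_subset_closure hp) (fun h' =>
          (hAB.closure_left hB).le_bot ⟨h', h⟩)
      · exact Or.inl h
    · exact Or.inr (hρ0 hpV)
  set Θ : ℝ × ℝ → AddCircle (1 : ℝ) := fun p => if p ∈ A then (ρ p : AddCircle (1 : ℝ)) else 0
    with hΘ
  have hΘc : Continuous Θ := by
    refine Continuous.if (fun p hp => ?_) ((AddCircle.continuous_mk' 1).comp ρ.continuous)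
      continuous_const
    rcases hfrA p hp with h | h
    · rw [hρ1 h]; exact AddCircle.coe_period 1
    · rw [h]; rfl
  obtain ⟨e₀, he₀⟩ := QuotientAddGroup.mk_surjective (Θ 0)
  obtain ⟨F, ⟨-, hF⟩, -⟩ := (AddCircle.isCoveringMap_coe (1 : ℝ)).existsUnique_continuousMap_lifts
    ⟨Θ, hΘc⟩ 0 e₀ he₀
  have hF' : ∀ p, (F p : AddCircle (1 : ℝ)) = Θ p := fun p => congrFun hF p
  set h : ℝ × ℝ → ℝ := fun p => if p ∈ A then ρ p else 0 with hh
  have hint : ∀ p, ∃ n : ℤ, F p - h p = n := by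
    intro p
    have h1 : ((F p : ℝ) : AddCircle (1 : ℝ)) = (h p : ℝ) := by
      rw [hF', hΘ, hh]
      by_cases hp : p ∈ A <;> simp [hp]
    rw [eq_comm, QuotientAddGroup.eq, AddSubgroup.mem_zmultiples_iff] at h1
    obtain ⟨n, hn⟩ := h1
    exact ⟨n, by rw [zsmul_one] at hn; rw [hn]; ring⟩
  have hcont : ∀ p ∉ Z, ContinuousAt h p := by
    intro p hp
    by_cases hρp : ρ p = 0
    · have h0 : h p = 0 := by simp only [hh]; split_ifs <;> simp [hρp]
      rw [ContinuousAt, h0]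
      refine squeeze_zero_norm (a := fun q => ‖ρ q‖) (fun q => ?_) ?_
      · simp only [hh]; split_ifs <;> simp
      · have := ρ.continuous.norm.tendsto p
        rwa [hρp, norm_zero] at this
    · have hpf : p ∉ frontier A := fun hf => (hfrA p hf).elim hp hρp
      by_cases hpA : p ∈ A
      · refine ρ.continuous.continuousAt.congr ?_
        filter_upwards [hA.mem_nhds hpA] with q hq
        simp [hh, hq]
      · have hpc : p ∈ (closure A)ᶜ := fun hc => hpf ⟨hc, by rwa [hA.interior_eq]⟩
        refine continuousAt_const.congr (f := fun _ => (0 : ℝ)) ?_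
        filter_upwards [isClosed_closure.isOpen_compl.mem_nhds hpc] with q hq
        have hqA : q ∉ A := fun hqA => hq (subset_closure hqA)
        simp [hh, hqA]
  have hloc : ∀ p ∉ Z, ∀ᶠ q in 𝓝 p, F q - h q = F p - h p := fun p hp =>
    eventually_eq_of_continuousAt_of_int (F.continuous.continuousAt.sub (hcont p hp)) hint
  obtain ⟨R, hR⟩ := hVc.isBounded.subset_closedBall (0 : ℝ × ℝ)
  have hR' : closure V ⊆ closedBall 0 |R| := hR.trans (closedBall_subset_closedBall (le_abs_self R))
  have hout : ∀ p ∈ (closedBall (0 : ℝ × ℝ) |R|)ᶜ, p ∉ V := fun p hp hpV =>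
    hp (hR' (subset_closure hpV))
  have hpre : IsPreconnected ((closedBall (0 : ℝ × ℝ) |R|)ᶜ) :=
    isPreconnected_compl_closedBall (by simp [one_add_one_eq_two]) (abs_nonneg R)
  obtain ⟨c₀, hc₀⟩ : ∃ c₀ : ℝ, ∀ p ∈ (closedBall (0 : ℝ × ℝ) |R|)ᶜ, F p - h p = c₀ := by
    obtain hne | ⟨p₀, hp₀⟩ := ((closedBall (0 : ℝ × ℝ) |R|)ᶜ).eq_empty_or_nonempty
    · exact ⟨0, by simp [hne]⟩
    · refine ⟨F p₀ - h p₀, fun p hp => ?_⟩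
      have hlc : ∀ x ∈ (closedBall (0 : ℝ × ℝ) |R|)ᶜ,
          ∀ᶠ y in 𝓝[(closedBall (0 : ℝ × ℝ) |R|)ᶜ] x, F x - h x = F y - h y := fun x hx =>
        ((hloc x fun hxZ => hout x hx (hZV hxZ)).mono fun y hy => hy.symm).filter_mono
          nhdsWithin_le_nhds
      exact (hpre.induction₂ (fun x y => F x - h x = F y - h y) hlc
        (fun x y z _ _ _ h1 h2 => h1.trans h2) (fun x y _ _ h1 => h1.symm) hp hp₀)
  set D : Set (ℝ × ℝ) := {p | p ∉ Z ∧ F p - h p ≠ c₀} with hD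
  have hDempty : D = ∅ := by
    apply hfill
    · rw [isOpen_iff_mem_nhds]
      rintro p ⟨hp, hpc⟩
      filter_upwards [hloc p hp, hZ.isOpen_compl.mem_nhds hp] with q hq hqZ
      exact ⟨hqZ, by rwa [hq]⟩
    · refine (isCompact_closedBall (0 : ℝ × ℝ) |R|).of_isClosed_subset isClosed_closure
        (closure_minimal (fun p hp => ?_) isClosed_closedBall)
      by_contra hpR
      exact hp.2 (hc₀ p hpR)
    · intro p hp
      by_contra hpZ
      have hev : ∀ᶠ q in 𝓝 p, q ∈ D ↔ p ∈ D := by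
        filter_upwards [hloc p hpZ, hZ.isOpen_compl.mem_nhds hpZ] with q hq hqZ
        simp only [hD, mem_ofPred_eq, hq, hpZ, not_false_eq_true, true_and]
        exact ⟨fun h => h.2, fun h => ⟨hqZ, h⟩⟩
      by_cases hpD : p ∈ D
      · exact hp.2 (mem_interior_iff_mem_nhds.2 (hev.mono fun q hq => hq.2 hpD))
      · obtain ⟨q, hq1, hq2⟩ := ((mem_closure_iff_frequently.1 hp.1).and_eventually hev).exists
        exact hpD (hq2.1 hq1)
    · exact disjoint_left.2 fun p hp => hp.1
  have hFout : ∀ p ∉ Z, F p - h p = c₀ := by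
    intro p hp
    by_contra hne
    have : p ∈ D := ⟨hp, hne⟩
    rw [hDempty] at this
    exact this
  have hFA : ∀ p ∈ A, F p = c₀ + ρ p := by
    intro p hp
    have := hFout p (disjoint_left.1 hAZ hp)
    simp only [hh, hp, if_true] at this
    linarith
  have hFB : ∀ p ∈ B, F p = c₀ := by
    intro p hp
    have := hFout p (disjoint_left.1 hBZ hp)
    simp only [hh, disjoint_right.1 hAB hp, if_false] at this
    linarith
  obtain ⟨n₀, hn₀⟩ : ∃ n : ℤ, c₀ = n := by
    have hnotall : ∃ p : ℝ × ℝ, p ∈ (closedBall (0 : ℝ × ℝ) |R|)ᶜ := by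
      by_contra! hall
      have : closedBall (0 : ℝ × ℝ) |R| = univ := by
        ext x; simpa using hall x
      exact noncompact_univ (ℝ × ℝ) (this ▸ isCompact_closedBall _ _)
    obtain ⟨p, hp⟩ := hnotall
    obtain ⟨n, hn⟩ := hint p
    exact ⟨n, by rw [← hn, hc₀ p hp]⟩
  have hFZ : ∀ p ∈ Z, ∃ n : ℤ, F p = n := by
    intro p hp
    obtain ⟨n, hn⟩ := hint p
    simp only [hh, disjoint_right.1 hAZ hp, if_false, sub_zero] at hn
    exact ⟨n, hn⟩
  refine ⟨A ∪ (V ∩ {p | c₀ < F p}), B ∪ (V ∩ {p | F p < c₀ + ρ p}),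
    hA.union (hV.inter (isOpen_lt continuous_const F.continuous)),
    hB.union (hV.inter (isOpen_lt F.continuous (continuous_const.add ρ.continuous))),
    ?_, ?_, ?_, ?_⟩
  · rw [disjoint_left]
    rintro p (hp | ⟨hpV, hp⟩) (hq | ⟨-, hq⟩)
    · exact disjoint_left.1 hAB hp hq
    · exact hq.ne (hFA p hp)
    · exact hp.ne' (hFB p hq)
    · rw [hVeq] at hpV
      rcases hpV with (h' | h') | h'
      · exact hq.ne (hFA p h')
      · exact hp.ne' (hFB p h')
      · obtain ⟨n, hn⟩ := hFZ p h'
        simp only [mem_ofPred_eq, hρ1 h', Pi.one_apply, hn, hn₀] at hp hq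
        have h1 : n₀ < n := by exact_mod_cast hp
        have h2 : n < n₀ + 1 := by exact_mod_cast hq
        lia
  · apply subset_antisymm
    · rintro p ((hp | hp) | (hp | hp))
      exacts [hAV hp, hp.1, hBV hp, hp.1]
    · intro p hpV
      have hpV' := hpV
      rw [hVeq] at hpV'
      rcases hpV' with (h' | h') | h'
      · exact Or.inl (Or.inl h')
      · exact Or.inr (Or.inl h')
      · rcases lt_or_ge c₀ (F p) with hlt | hle
        · exact Or.inl (Or.inr ⟨hpV, hlt⟩)
        · refine Or.inr (Or.inr ⟨hpV, ?_⟩)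
          simp only [mem_ofPred_eq, hρ1 h', Pi.one_apply]
          linarith
  · rw [disjoint_left]
    rintro p (hp | ⟨-, hp⟩) hq
    · exact disjoint_left.1 hAB hp hq
    · exact hp.ne' (hFB p hq)
  · rw [disjoint_left]
    rintro p (hp | ⟨-, hp⟩) hq
    · exact disjoint_left.1 hAB hq hp
    · exact hp.ne (hFA p hq)

end PlaneTopology

section MainArgument

open Filter Topology Set
open scoped ContDiff

theorem SolvesTranslatorEq.pdt_le {σ c : ℝ} {Ω : Set (ℝ × ℝ)} {u : ℝ × ℝ → ℝ}
    (hΩ : IsOpen Ω) (hu : ContDiffOn ℝ ∞ u Ω) (h : SolvesTranslatorEq σ c Ω u)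
    {D : Set (ℝ × ℝ)} (hD : IsOpen D) (hcpt : IsCompact (closure D)) (hDΩ : closure D ⊆ Ω)
    {m : ℝ} (hm : ∀ p ∈ frontier D, pdt u p ≤ m) : ∀ p ∈ D, pdt u p ≤ m := by
  have hs := (contDiffOn_pds hΩ hu).continuousOn
  have ht := (contDiffOn_pdt hΩ hu).continuousOn
  have hts := (contDiffOn_pdt hΩ (contDiffOn_pds hΩ hu)).continuousOn
  have htt := (contDiffOn_pdt hΩ (contDiffOn_pdt hΩ hu)).continuousOn
  exact le_of_le_frontier_of_elliptic hΩ (contDiffOn_pdt hΩ hu) (by fun_prop)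
    (h.pdt_eq hΩ hu) hD hcpt hDΩ hm

theorem SolvesTranslatorEq.le_pdt {σ c : ℝ} {Ω : Set (ℝ × ℝ)} {u : ℝ × ℝ → ℝ}
    (hΩ : IsOpen Ω) (hu : ContDiffOn ℝ ∞ u Ω) (h : SolvesTranslatorEq σ c Ω u)
    {D : Set (ℝ × ℝ)} (hD : IsOpen D) (hcpt : IsCompact (closure D)) (hDΩ : closure D ⊆ Ω)
    {m : ℝ} (hm : ∀ p ∈ frontier D, m ≤ pdt u p) : ∀ p ∈ D, m ≤ pdt u p := by
  have hs := (contDiffOn_pds hΩ hu).continuousOn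
  have ht := (contDiffOn_pdt hΩ hu).continuousOn
  have hts := (contDiffOn_pdt hΩ (contDiffOn_pds hΩ hu)).continuousOn
  have htt := (contDiffOn_pdt hΩ (contDiffOn_pdt hΩ hu)).continuousOn
  exact le_of_frontier_le_of_elliptic hΩ (contDiffOn_pdt hΩ hu) (by fun_prop)
    (h.pdt_eq hΩ hu) hD hcpt hDΩ hm

theorem exists_gt_forall_frontier_le {X : Type*} [TopologicalSpace X] {w : X → ℝ} {τ : ℝ}
    {P : Set X} (hP : IsCompact (closure P)) (hw : ContinuousOn w (closure P))
    (hlt : ∀ p ∈ frontier P, τ < w p) : ∃ m, τ < m ∧ ∀ p ∈ frontier P, m ≤ w p := by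
  obtain hne | hne := (frontier P).eq_empty_or_nonempty
  · exact ⟨τ + 1, by simp, by simp [hne]⟩
  · obtain ⟨q, hq, hmin⟩ := (hP.of_isClosed_subset isClosed_frontier
      frontier_subset_closure).exists_isMinOn hne (hw.mono frontier_subset_closure)
    exact ⟨w q, hlt q hq, fun p hp => hmin hp⟩

theorem frontier_disjoint_union {X : Type*} [TopologicalSpace X] {P Q V : Set X}
    (hP : IsOpen P) (hQ : IsOpen Q) (hPQ : Disjoint P Q) (hV : P ∪ Q = V) :
    frontier P ⊆ closure V \ V := by
  intro p hp
  refine ⟨closure_mono (hV ▸ subset_union_left) hp.1, fun hpV => ?_⟩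
  rw [← hV] at hpV
  rcases hpV with h | h
  · exact hp.2 (by rwa [hP.interior_eq])
  · exact (hPQ.closure_left hQ).le_bot ⟨hp.1, h⟩

/-- No level set of `u_t` has a compact connected component, if the graph of `u` is complete. -/
theorem SolvesTranslatorEq.not_isCompact_component {σ c : ℝ} (hc : c ≠ 0) {Ω : Set (ℝ × ℝ)}
    {u : ℝ × ℝ → ℝ} (hΩ : IsOpen Ω) (hu : ContDiffOn ℝ ∞ u Ω) (h : SolvesTranslatorEq σ c Ω u)
    (hclosed : ∀ B : ℝ, IsClosed {p | p ∈ Ω ∧ |u p| ≤ B}) (τ : ℝ) {p : ℝ × ℝ}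
    (hp : p ∈ {p | p ∈ Ω ∧ pdt u p = τ}) :
    ¬ IsCompact (connectedComponentIn {p | p ∈ Ω ∧ pdt u p = τ} p) := by
  intro hcpt
  have hwc : ContinuousOn (pdt u) Ω := (contDiffOn_pdt hΩ hu).continuousOn
  have hZcl : ∀ C ⊆ Ω, IsClosed C → IsClosed ({p | p ∈ Ω ∧ pdt u p = τ} ∩ C) := by
    intro C hC hCc
    have : {p | p ∈ Ω ∧ pdt u p = τ} ∩ C = C ∩ pdt u ⁻¹' {τ} := by
      ext x
      exact ⟨fun hx => ⟨hx.2, hx.1.2⟩, fun hx => ⟨⟨hC hx.1, hx.2⟩, hx.1⟩⟩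
    rw [this]
    exact (hwc.mono hC).preimage_isClosed_of_isClosed hCc isClosed_singleton
  obtain ⟨V, hV, hpV, hVc, hVΩ, hZV⟩ :=
    exists_isolated_of_isCompact_connectedComponentIn hΩ (fun x hx => hx.1) hZcl hp hcpt
  have hVΩ' : V ⊆ Ω := subset_closure.trans hVΩ
  have hne : ∀ q ∈ closure V \ V, pdt u q ≠ τ := fun q hq hqτ =>
    hq.2 (hZV ⟨⟨hVΩ hq.1, hqτ⟩, hq.1⟩)
  obtain ⟨P, Q, hP, hQ, hPQ, hPQV, hPB, hQA⟩ := exists_isOpen_splitting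
    (Z := {p | p ∈ Ω ∧ pdt u p = τ} ∩ closure V) (V := V)
    (A := V ∩ pdt u ⁻¹' Ioi τ) (B := V ∩ pdt u ⁻¹' Iio τ)
    ((hwc.mono hVΩ').isOpen_inter_preimage hV isOpen_Ioi)
    ((hwc.mono hVΩ').isOpen_inter_preimage hV isOpen_Iio) hV hVc (hZcl _ hVΩ isClosed_closure)
    (disjoint_left.2 fun q h1 h2 => (show τ < pdt u q from h1.2).asymm h2.2)
    (disjoint_left.2 fun q h1 h2 => h1.2.ne' h2.1.2)
    (disjoint_left.2 fun q h1 h2 => h1.2.ne h2.1.2)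
    (by
      apply subset_antisymm
      · intro q hq
        rcases lt_trichotomy (pdt u q) τ with h1 | h1 | h1
        · exact Or.inl (Or.inr ⟨hq, h1⟩)
        · exact Or.inr ⟨⟨hVΩ' hq, h1⟩, subset_closure hq⟩
        · exact Or.inl (Or.inl ⟨hq, h1⟩)
      · exact union_subset (union_subset inter_subset_left inter_subset_left) hZV)
    (by
      intro D hD hDc hDfr hDZ
      have hDΩ : closure D ⊆ Ω :=
        h.closure_subset hc hΩ hu hclosed hD hDc fun q hq => (hDfr hq).1.1
      have hDτ : ∀ q ∈ D, pdt u q = τ := fun q hq => le_antisymm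
        (h.pdt_le hΩ hu hD hDc hDΩ (fun q hq => (hDfr hq).1.2.le) q hq)
        (h.le_pdt hΩ hu hD hDc hDΩ (fun q hq => (hDfr hq).1.2.ge) q hq)
      have hDV : Disjoint D V := disjoint_left.2 fun q hq hqV => disjoint_left.1 hDZ hq
        ⟨⟨hDΩ (subset_closure hq), hDτ q hq⟩, subset_closure hqV⟩
      have hfr : frontier D = ∅ := by
        rw [eq_empty_iff_forall_notMem]
        intro q hq
        exact (hDV.closure_left hV).le_bot ⟨hq.1, hZV (hDfr hq)⟩
      rcases frontier_eq_empty_iff.1 hfr with h1 | h1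
      · exact h1
      · rw [h1, closure_univ] at hDc
        exact absurd hDc (noncompact_univ _))
  have hPV : P ⊆ V := hPQV ▸ subset_union_left
  have hQV : Q ⊆ V := hPQV ▸ subset_union_right
  have hPc : IsCompact (closure P) := hVc.of_isClosed_subset isClosed_closure (closure_mono hPV)
  have hQc : IsCompact (closure Q) := hVc.of_isClosed_subset isClosed_closure (closure_mono hQV)
  have hPΩ : closure P ⊆ Ω := (closure_mono hPV).trans hVΩ
  have hQΩ : closure Q ⊆ Ω := (closure_mono hQV).trans hVΩ
  have hpPQ : p ∈ P ∪ Q := hPQV ▸ hpV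
  rcases hpPQ with hpP | hpQ
  · have hge : ∀ q ∈ closure P, τ ≤ pdt u q := fun q hq =>
      le_on_closure (fun x hx => not_lt.1 fun hlt => disjoint_left.1 hPB hx ⟨hPV hx, hlt⟩)
        continuousOn_const (hwc.mono hPΩ) hq
    obtain ⟨m, hm, hmle⟩ := exists_gt_forall_frontier_le hPc (hwc.mono hPΩ) fun q hq =>
      (hge q hq.1).lt_of_ne' (hne q (frontier_disjoint_union hP hQ hPQ hPQV hq))
    have := h.le_pdt hΩ hu hP hPc hPΩ hmle p hpP
    rw [hp.2] at this
    exact this.not_gt hm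
  · have hle : ∀ q ∈ closure Q, pdt u q ≤ τ := fun q hq =>
      le_on_closure (fun x hx => not_lt.1 fun hlt => disjoint_left.1 hQA hx ⟨hQV hx, hlt⟩)
        (hwc.mono hQΩ) continuousOn_const hq
    obtain ⟨m, hm, hmle⟩ := exists_gt_forall_frontier_le (w := fun q => -pdt u q) (τ := -τ) hQc
      (hwc.mono hQΩ).neg fun q hq => neg_lt_neg ((hle q hq.1).lt_of_ne
        (hne q (frontier_disjoint_union hQ hP hPQ.symm (union_comm Q P ▸ hPQV) hq)))
    have := h.pdt_le hΩ hu hQ hQc hQΩ (m := -m) (fun q hq => le_neg.1 (hmle q hq)) p hpQ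
    rw [hp.2] at this
    linarith

end MainArgument

section Coordinates

open Filter Topology Set
open scoped ContDiff

theorem connectedComponentIn_eq_image_of_leftInvOn {X Y : Type*} [TopologicalSpace X]
    [TopologicalSpace Y] {f : X → Y} {g : Y → X} {Z : Set X} (hf : ContinuousOn f Z)
    (hg : Continuous g) (hgf : LeftInvOn g f Z) {p : X} (hp : p ∈ Z) :
    connectedComponentIn Z p = g '' connectedComponentIn (f '' Z) (f p) := by
  apply subset_antisymm
  · have h1 : f '' connectedComponentIn Z p ⊆ connectedComponentIn (f '' Z) (f p) :=
      (isPreconnected_connectedComponentIn.image f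
        (hf.mono (connectedComponentIn_subset Z p))).subset_connectedComponentIn
        (mem_image_of_mem f (mem_connectedComponentIn hp))
        (image_mono (connectedComponentIn_subset Z p))
    intro x hx
    exact ⟨f x, h1 (mem_image_of_mem f hx), hgf (connectedComponentIn_subset Z p hx)⟩
  · refine (isPreconnected_connectedComponentIn.image g
      hg.continuousOn).subset_connectedComponentIn
      ⟨f p, mem_connectedComponentIn (mem_image_of_mem f hp), hgf hp⟩ ?_
    rintro _ ⟨y, hy, rfl⟩
    obtain ⟨x, hx, rfl⟩ := connectedComponentIn_subset _ _ hy
    rwa [hgf hx]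

theorem inner_e3_e1 : ⟪e3, e1⟫ = (0 : ℝ) := by
  simp [e1, e3, EuclideanSpace.inner_single_left]

theorem inner_e3_bθ (θ : ℝ) : ⟪e3, bθ θ⟫ = cos θ := by
  simp [e2, e3, bθ, EuclideanSpace.inner_single_left, inner_sub_right, inner_smul_right]

theorem inner_e3_vθ (θ : ℝ) : ⟪e3, vθ θ⟫ = sin θ := by
  simp [e2, e3, vθ, EuclideanSpace.inner_single_left, inner_add_right, inner_smul_right]

theorem inner_gaussMapθ_eq_zero_iff (θ : ℝ) (u : ℝ × ℝ → ℝ) (p : ℝ × ℝ) :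
    ⟪gaussMapθ θ u p, e3⟫ = (0 : ℝ) ↔ sin θ - cos θ * pdt u p = 0 := by
  have hpos : 0 < Real.sqrt (1 + (pds u p) ^ 2 + (pdt u p) ^ 2) := by positivity
  rw [gaussMapθ, real_inner_comm, inner_smul_right, inner_sub_right, inner_sub_right,
    inner_smul_right, inner_smul_right, inner_e3_e1, inner_e3_bθ, inner_e3_vθ,
    mul_eq_zero_iff_left (inv_pos.2 hpos).ne', mul_zero, sub_zero, mul_comm]

variable {θ : ℝ} {Ω : Set (ℝ × ℝ)} {u : ℝ × ℝ → ℝ} {S : Set E3}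

theorem IsTranslatingGraph.solvesTranslatorEq (h : IsTranslatingGraph e1 (bθ θ) (vθ θ) Ω u S) :
    SolvesTranslatorEq (sin θ) (cos θ) Ω u := by
  intro p hp
  have := h.pde p hp
  rw [inner_e3_e1, inner_e3_bθ, inner_e3_vθ, mul_zero, sub_zero, mul_comm _ (cos θ)] at this
  exact this

theorem IsTranslatingGraph.inner_a {a b v : E3} (h : IsTranslatingGraph a b v Ω u S)
    (x y z : ℝ) : ⟪a, x • a + y • b + z • v⟫ = x := by
  simp [inner_add_right, inner_smul_right, h.inner_ab, h.inner_av, h.norm_a]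

theorem IsTranslatingGraph.inner_b {a b v : E3} (h : IsTranslatingGraph a b v Ω u S)
    (x y z : ℝ) : ⟪b, x • a + y • b + z • v⟫ = y := by
  simp [inner_add_right, inner_smul_right, real_inner_comm a b, h.inner_ab, h.inner_bv, h.norm_b]

theorem IsTranslatingGraph.inner_v {a b v : E3} (h : IsTranslatingGraph a b v Ω u S)
    (x y z : ℝ) : ⟪v, x • a + y • b + z • v⟫ = z := by
  simp [inner_add_right, inner_smul_right, real_inner_comm a v, real_inner_comm b v, h.inner_av,
    h.inner_bv, h.norm_v]

theorem IsTranslatingGraph.mem_iff {a b v : E3} (h : IsTranslatingGraph a b v Ω u S)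
    (p : ℝ × ℝ) (z : ℝ) : p.1 • a + p.2 • b + z • v ∈ S ↔ p ∈ Ω ∧ u p = z := by
  rw [h.graph_eq]
  constructor
  · rintro ⟨q, hq, he⟩
    have h1 := congrArg (fun x => ⟪a, x⟫) he
    have h2 := congrArg (fun x => ⟪b, x⟫) he
    have h3 := congrArg (fun x => ⟪v, x⟫) he
    simp only [h.inner_a, h.inner_b, h.inner_v] at h1 h2 h3
    obtain rfl : p = q := Prod.ext h1 h2
    exact ⟨hq, h3.symm⟩
  · rintro ⟨hp, rfl⟩
    exact ⟨p, hp, rfl⟩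

theorem IsTranslatingGraph.isClosed_abs_le {a b v : E3} (h : IsTranslatingGraph a b v Ω u S)
    (hS : IsClosed S) (B : ℝ) : IsClosed {p | p ∈ Ω ∧ |u p| ≤ B} := by
  have h1 : IsClosed {x : (ℝ × ℝ) × Icc (-B) B | x.1.1 • a + x.1.2 • b + (x.2 : ℝ) • v ∈ S} :=
    hS.preimage (by fun_prop)
  convert isClosedMap_fst_of_compactSpace _ h1 using 1
  ext p
  simp only [h.mem_iff, mem_image, Set.mem_ofPred_eq]
  constructor
  · rintro ⟨hp, hB⟩
    exact ⟨(p, ⟨u p, abs_le.1 hB⟩), ⟨hp, rfl⟩, rfl⟩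
  · rintro ⟨⟨p, z⟩, ⟨hp, hz⟩, rfl⟩
    exact ⟨hp, abs_le.2 (hz ▸ z.2)⟩

theorem IsTranslatingGraph.continuousOn_graphPtθ
    (h : IsTranslatingGraph e1 (bθ θ) (vθ θ) Ω u S) : ContinuousOn (graphPtθ θ u) Ω := by
  have hu := h.smooth.continuousOn
  unfold graphPtθ
  fun_prop

end Coordinates

/-- the zero set of the mean curvature of a complete connected translating
graph has no nonempty compact connected component. -/
theorem stmt17 (θ : ℝ) (hθ : θ ∈ Set.Ico 0 π) (Ω : Set (ℝ × ℝ)) (u : ℝ × ℝ → ℝ) (S : Set E3)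
    (hgraph : IsTranslatingGraph e1 (bθ θ) (vθ θ) Ω u S) (hcomplete : IsClosed S)
    (H : Set E3)
    (hH : H = {q : E3 | ∃ p ∈ Ω, graphPtθ θ u p = q ∧ ⟪gaussMapθ θ u p, e3⟫ = 0}) :
    ∀ q ∈ H, ¬ IsCompact (connectedComponentIn H q) := by
  subst hH
  rintro q ⟨p, hp, rfl, hpN⟩ hcpt
  have hc : cos θ ≠ 0 := by
    intro hc
    rw [inner_gaussMapθ_eq_zero_iff, hc, zero_mul, sub_zero] at hpN
    have := sin_sq_add_cos_sq θ
    simp [hpN, hc] at this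
  have hiff : ∀ p, ⟪gaussMapθ θ u p, e3⟫ = 0 ↔ pdt u p = sin θ / cos θ := by
    intro p
    rw [inner_gaussMapθ_eq_zero_iff, eq_div_iff hc, sub_eq_zero, eq_comm, mul_comm]
  have hpZ : p ∈ {p | p ∈ Ω ∧ pdt u p = sin θ / cos θ} := ⟨hp, (hiff p).1 hpN⟩
  have himage : {q : E3 | ∃ p ∈ Ω, graphPtθ θ u p = q ∧ ⟪gaussMapθ θ u p, e3⟫ = 0}
      = graphPtθ θ u '' {p | p ∈ Ω ∧ pdt u p = sin θ / cos θ} := by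
    ext q
    constructor
    · rintro ⟨p, hp, rfl, hpN⟩
      exact ⟨p, ⟨hp, (hiff p).1 hpN⟩, rfl⟩
    · rintro ⟨p, ⟨hp, hpN⟩, rfl⟩
      exact ⟨p, hp, rfl, (hiff p).2 hpN⟩
  rw [himage] at hcpt
  have hg : Continuous fun x : E3 => (⟪e1, x⟫, ⟪bθ θ, x⟫) := by fun_prop
  refine hgraph.solvesTranslatorEq.not_isCompact_component hc hgraph.isOpen_dom hgraph.smooth
    (hgraph.isClosed_abs_le hcomplete) _ hpZ ?_
  rw [connectedComponentIn_eq_image_of_leftInvOn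
    (hgraph.continuousOn_graphPtθ.mono fun x hx => hx.1) hg
    (fun x _ => Prod.ext (hgraph.inner_a _ _ _) (hgraph.inner_b _ _ _)) hpZ]
  exact hcpt.image hg
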